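/- Let k be a field of characteristic ≠ 2, let M be a semi-simple module with characteristic polynomial F_M, and let d ∈ k* be such that d·F_M(1)·F_M(−1) is a square in k (possibly 0). Then there exists a quadratic space q over k with det(q) = d in k*/k*² having an isometry with module M. -/

import Mathlib

open Polynomial

noncomputable section

variable {k : Type} [Field k]

/-- `f*(X) = f(0)⁻¹ X^{deg f} f(1/X)`. -/
def starPoly (f : k[X]) : k[X] := Polynomial.C (f.coeff 0)⁻¹ * f.reverse

/-- Type 0 : a product of powers of `X - 1` and `X + 1`. -/
def IsType0Pol (f : k[X]) : Prop := ∃ a b : ℕ, f = (X - 1 : k[X]) ^ a * (X + 1) ^ b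

/-- Type 1 : a product of (powers of) monic symmetric irreducible polynomials of even degree. -/
def IsType1Pol (f : k[X]) : Prop :=
  ∃ s : Multiset k[X],
    (∀ g ∈ s, g.Monic ∧ Irreducible g ∧ g = g.reverse ∧ Even g.natDegree) ∧ f = s.prod

/-- Type 2 : a product of polynomials `g * g*` with `g` monic irreducible, `g ≠ ±g*`. -/
def IsType2Pol (f : k[X]) : Prop :=
  ∃ s : Multiset k[X],
    (∀ g ∈ s, g.Monic ∧ Irreducible g ∧ g ≠ starPoly g ∧ g ≠ -starPoly g) ∧
    f = (s.map fun g => g * starPoly g).prod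

/-- A monic polynomial is hyperbolic if it is of the form `G·G*`; equivalently, all its
components of type 0 and 1 occur with an even exponent. -/
def IsHyperbolicPoly (f : k[X]) : Prop := ∃ g : k[X], g.Monic ∧ f = g * starPoly g

/-- Data describing a self-dual torsion `k[X]`-module which is finite dimensional over `k`:
the direct sum, over `i`, of `[k[X]/(f i ^ e i)]^(n i)`, where each `f i` is monic
irreducible, and where the collection is self-dual (stable under `f ↦ f*`). -/
structure ModuleData (k : Type) [Field k] where
  ι : Type
  [fin : Fintype ι]
  f : ι → k[X]
  e : ι → ℕ
  n : ι → ℕ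
  monic : ∀ i, (f i).Monic
  irr : ∀ i, Irreducible (f i)
  epos : ∀ i, 0 < e i
  npos : ∀ i, 0 < n i
  selfdual : ∃ σ : Equiv.Perm ι,
    ∀ i, f (σ i) = starPoly (f i) ∧ e (σ i) = e i ∧ n (σ i) = n i

attribute [instance] ModuleData.fin

namespace ModuleData

variable (D : ModuleData k)

/-- The underlying `K[X]`-module of `M ⊗_k K`, realised concretely, for an extension
`ι : k →+* K`. -/
abbrev SpaceVia {K : Type} [Field K] (ι : k →+* K) : Type :=
  (i : D.ι) → Fin (D.n i) →
    (Polynomial K ⧸ Ideal.span {((D.f i).map ι) ^ D.e i})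

/-- The dimension of `M` as a `k`-vector space. -/
def dim : ℕ := ∑ i, D.n i * (D.e i * (D.f i).natDegree)

/-- The characteristic polynomial `F_M` of `M`. -/
def charPoly : k[X] := ∏ i, D.f i ^ (D.n i * D.e i)

/-- The summand `i` is of type 0 : `f i` is `X - 1` or `X + 1`. -/
def IsIdx0 (i : D.ι) : Prop := D.f i = X - 1 ∨ D.f i = X + 1

/-- The summand `i` is of type 1 : `f i` is symmetric of even degree. -/
def IsIdx1 (i : D.ι) : Prop := D.f i = (D.f i).reverse ∧ Even (D.f i).natDegree

/-- The summand `i` is of type 2 : `f i` is not self-dual. -/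
def IsIdx2 (i : D.ι) : Prop := D.f i ≠ starPoly (D.f i)

open Classical in
/-- `dim_k M⁰`. -/
def dim0 : ℕ := ∑ i, if D.IsIdx0 i then D.n i * (D.e i * (D.f i).natDegree) else 0

open Classical in
/-- `dim_k M¹`. -/
def dim1 : ℕ := ∑ i, if D.IsIdx1 i then D.n i * (D.e i * (D.f i).natDegree) else 0

open Classical in
/-- `dim_k M²`. -/
def dim2 : ℕ := ∑ i, if D.IsIdx2 i then D.n i * (D.e i * (D.f i).natDegree) else 0

/-- `M` is semi-simple : all exponents are 1. -/
def Semisimple : Prop := ∀ i, D.e i = 1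

/-- `M̄_odd` : the direct sum of the summands `[k[X]/(f)]^n`, over those summands
`[k[X]/(f^e)]^n` of `M` with `e` odd and `f` self-dual (`f = f*`). -/
def oddBar : ModuleData k where
  ι := {i : D.ι // Odd (D.e i) ∧ D.f i = starPoly (D.f i)}
  fin := by classical exact inferInstance
  f i := D.f i.1
  e _ := 1
  n i := D.n i.1
  monic i := D.monic i.1
  irr i := D.irr i.1
  epos _ := one_pos
  npos i := D.npos i.1
  selfdual := ⟨Equiv.refl _, fun i => ⟨i.2.2, rfl, rfl⟩⟩

end ModuleData

theorem starPoly_eq_self_of_symm {f : k[X]} (hm : f.Monic) (hs : f = f.reverse) :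
    starPoly f = f := by
  have h0 : f.coeff 0 = 1 := by
    conv_lhs => rw [hs]
    rw [Polynomial.coeff_zero_reverse]
    exact hm
  rw [starPoly, h0, inv_one, map_one, one_mul, ← hs]

/-- The module `[k[X]/(f)]^m` for a monic symmetric irreducible `f`. -/
def ModuleData.single (f : k[X]) (hmon : f.Monic) (hirr : Irreducible f)
    (hsym : f = f.reverse) (m : ℕ) (hm : 0 < m) : ModuleData k where
  ι := Unit
  fin := inferInstance
  f _ := f
  e _ := 1
  n _ := m
  monic _ := hmon
  irr _ := hirr
  epos _ := one_pos
  npos _ := hm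
  selfdual := ⟨Equiv.refl _, fun _ => ⟨(starPoly_eq_self_of_symm hmon hsym).symm, rfl, rfl⟩⟩

section Bilin

variable {V : Type} [AddCommGroup V] [Module k V]

/-- `t` is an isometry of the bilinear space `(V, B)`. -/
def IsIsometryOf (B : LinearMap.BilinForm k V) (t : V ≃ₗ[k] V) : Prop :=
  ∀ x y, B (t x) (t y) = B x y

/-- `(V, B)` is a quadratic space : `B` is a symmetric bilinear form of non-zero
determinant (equivalently, non-degenerate). -/
def IsQuadraticSpace (B : LinearMap.BilinForm k V) : Prop :=
  (∀ x y, B x y = B y x) ∧ (∀ x, (∀ y, B x y = 0) → x = 0)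

/-- The bilinear space `(W, B)` over an extension `ι : k →+* K` has an isometry whose
associated `K[X]`-module is `M ⊗_k K`. -/
def HasIsometryWithModuleVia {K : Type} [Field K] (ι : k →+* K)
    {W : Type} [AddCommGroup W] [Module K W]
    (B : LinearMap.BilinForm K W) (D : ModuleData k) : Prop :=
  ∃ t : W ≃ₗ[K] W, IsIsometryOf B t ∧
    ∃ φ : W ≃ₗ[K] D.SpaceVia ι, ∀ w, φ (t w) = (X : Polynomial K) • φ w

/-- `(V, B)` has an isometry with module `M`. -/
def HasIsometryWithModule (B : LinearMap.BilinForm k V) (D : ModuleData k) : Prop :=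
  HasIsometryWithModuleVia (RingHom.id k) B D

/-- The bilinear space `(W, B)` over an extension `ι : k →+* K` has an isometry with
minimal polynomial (the image of) `f`. -/
def HasIsometryWithMinpolyVia {K : Type} [Field K] (ι : k →+* K)
    {W : Type} [AddCommGroup W] [Module K W]
    (B : LinearMap.BilinForm K W) (f : k[X]) : Prop :=
  ∃ t : W ≃ₗ[K] W, IsIsometryOf B t ∧ minpoly K t.toLinearMap = f.map ι

/-- `(V, B)` has an isometry with minimal polynomial `f`. -/
def HasIsometryWithMinpoly (B : LinearMap.BilinForm k V) (f : k[X]) : Prop :=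
  ∃ t : V ≃ₗ[k] V, IsIsometryOf B t ∧ minpoly k t.toLinearMap = f

/-- A (2n)-dimensional quadratic space is hyperbolic if it has a self-orthogonal subspace
of dimension n. -/
def IsHyperbolicSpace (B : LinearMap.BilinForm k V) : Prop :=
  ∃ W : Submodule k V, (∀ x ∈ W, ∀ y ∈ W, B x y = 0) ∧
    2 * Module.finrank k W = Module.finrank k V

/-- The Witt index : the largest dimension of a totally isotropic subspace. -/
def wittIndex (B : LinearMap.BilinForm k V) : ℕ :=
  sSup {m | ∃ W : Submodule k V, (∀ x ∈ W, ∀ y ∈ W, B x y = 0) ∧ Module.finrank k W = m}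

variable [FiniteDimensional k V]

/-- The Gram matrix of `B` with respect to a fixed basis. -/
def gramOf (B : LinearMap.BilinForm k V) :
    Matrix (Fin (Module.finrank k V)) (Fin (Module.finrank k V)) k :=
  LinearMap.toMatrix₂ (Module.finBasis k V) (Module.finBasis k V) B

/-- The determinant of `B` (well defined modulo nonzero squares). -/
def detOf (B : LinearMap.BilinForm k V) : k := (gramOf B).det

end Bilin

theorem Matrix.isSquare_det_of_transpose_eq_neg (hchar : (2 : k) ≠ 0) {m : Type*} [Fintype m]
    [DecidableEq m] (A : Matrix m m k) (hA : A.transpose = -A) : IsSquare A.det := by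
  induction hN : Fintype.card m using Nat.strong_induction_on generalizing m with
  | _ N ih =>
  by_cases hz : ∃ i j, A i j ≠ 0
  · obtain ⟨i, j, hij⟩ := hz
    have hskew : ∀ a b, A b a = -A a b := fun a b => congrFun (congrFun hA a) b
    have hdiag : ∀ a, A a a = 0 := fun a => by
      have h2 : (2 : k) * A a a = 0 := by linear_combination hskew a a
      exact (mul_eq_zero.1 h2).resolve_left hchar
    have hne : i ≠ j := by rintro rfl; exact hij (hdiag i)
    let p : m → Prop := fun a => a = i ∨ a = j
    have hdet : (A.toBlock p p).det = A i j ^ 2 := by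
      let e : Fin 2 ≃ {a // p a} := Equiv.ofBijective
        ![⟨i, Or.inl rfl⟩, ⟨j, Or.inr rfl⟩] (by
          constructor
          · intro a b hab
            fin_cases a <;> fin_cases b <;> first
              | rfl
              | exact absurd (congrArg Subtype.val hab) hne
              | exact absurd (congrArg Subtype.val hab) hne.symm
          · rintro ⟨a, rfl | rfl⟩
            · exact ⟨0, rfl⟩
            · exact ⟨1, rfl⟩)
      rw [← Matrix.det_submatrix_equiv_self e, Matrix.det_fin_two]
      change A i i * A j j - A i j * A j i = _
      rw [hdiag, hskew i j]
      ring
    have hu : IsUnit (A.toBlock p p).det := by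
      rw [hdet]; exact (pow_ne_zero 2 hij).isUnit
    let := Matrix.invertibleOfIsUnitDet _ hu
    rw [Matrix.det_toBlock A p, Matrix.det_fromBlocks₁₁, hdet]
    refine (IsSquare.sq _).mul (ih _ ?_ _ ?_ rfl)
    · rw [← hN]
      exact Fintype.card_subtype_lt (x := i) (by simp [p])
    · have h11 : (A.toBlock p p).transpose = -A.toBlock p p := by
        ext a b; exact hskew _ _
      have h12 : (A.toBlock p fun a => ¬p a).transpose = -A.toBlock (fun a => ¬p a) p := by
        ext a b; exact hskew _ _
      have h21 : (A.toBlock (fun a => ¬p a) p).transpose = -A.toBlock p fun a => ¬p a := by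
        ext a b; exact hskew _ _
      have h22 : (A.toBlock (fun a => ¬p a) fun a => ¬p a).transpose =
          -A.toBlock (fun a => ¬p a) fun a => ¬p a := by
        ext a b; exact hskew _ _
      have hinv : (-A.toBlock p p)⁻¹ = -(A.toBlock p p)⁻¹ := Matrix.inv_eq_right_inv (by
        rw [neg_mul_neg, Matrix.mul_nonsing_inv _ hu])
      rw [Matrix.invOf_eq_nonsing_inv, Matrix.transpose_sub, Matrix.transpose_mul,
        Matrix.transpose_mul, Matrix.transpose_nonsing_inv, h11, h12, h21, h22, hinv]
      simp only [Matrix.mul_assoc, Matrix.neg_mul, Matrix.mul_neg, neg_neg]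
      abel
  · push Not at hz
    rcases isEmpty_or_nonempty m with _ | _
    · rw [Matrix.det_isEmpty]; exact IsSquare.one
    · rw [show A = 0 from Matrix.ext hz, Matrix.det_zero]; exact IsSquare.zero

theorem Matrix.isSquare_det_mul_of_isometry (hchar : (2 : k) ≠ 0) {m : Type*} [Fintype m]
    [DecidableEq m] (G T : Matrix m m k) (hG : G.transpose = G) (hG0 : G.det ≠ 0)
    (hT : T.transpose * G * T = G) (hT1 : T.charpoly.eval (-1) ≠ 0) :
    IsSquare (G.det * (T.charpoly.eval 1 * T.charpoly.eval (-1))) := by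
  have h1 : T.charpoly.eval 1 = (1 - T).det := by
    rw [Matrix.eval_charpoly, map_one]
  have h2 : T.charpoly.eval (-1) = (-1 - T).det := by
    rw [Matrix.eval_charpoly, map_neg, map_one]
  rw [h2] at hT1
  have hdetT : T.det = 1 := by
    have h : T.transpose * G * (-1 - T) = (-1 - T).transpose * G := by
      rw [Matrix.mul_sub, hT, Matrix.transpose_sub, Matrix.sub_mul, Matrix.transpose_neg,
        Matrix.transpose_one, Matrix.mul_neg, Matrix.mul_one, Matrix.neg_mul, Matrix.one_mul]
      abel
    have h' := congrArg Matrix.det h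
    simp only [Matrix.det_mul, Matrix.det_transpose] at h'
    exact mul_right_cancel₀ (mul_ne_zero hT1 hG0) (by linear_combination h')
  have hskew : (G * T - T.transpose * G).transpose = -(G * T - T.transpose * G) := by
    simp only [Matrix.transpose_sub, Matrix.transpose_mul, hG, Matrix.transpose_transpose]
    abel
  have h : (G * T - T.transpose * G) * T = G * ((1 - T) * (-1 - T)) := by
    rw [Matrix.sub_mul, hT]
    noncomm_ring
  have h' := congrArg Matrix.det h
  simp only [Matrix.det_mul, hdetT, mul_one] at h'
  rw [h1, h2, ← h']
  exact Matrix.isSquare_det_of_transpose_eq_neg hchar _ hskew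

theorem Matrix.det_add_smul_vecMulVec {m : Type*} [Fintype m] [DecidableEq m]
    (G : Matrix m m k) (v w : m → k) (c : k) :
    (G + c • Matrix.vecMulVec (G.mulVec v) w).det = G.det * (1 + c * (w ⬝ᵥ v)) := by
  have h : G + c • Matrix.vecMulVec (G.mulVec v) w =
      G * (1 + Matrix.replicateCol Unit (c • v) * Matrix.replicateRow Unit w) := by
    rw [Matrix.mul_add, Matrix.mul_one, ← Matrix.mul_assoc, ← Matrix.replicateCol_mulVec,
      ← Matrix.vecMulVec_eq, Matrix.mulVec_smul, Matrix.smul_vecMulVec]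
  rw [h, Matrix.det_mul, Matrix.det_one_add_replicateCol_mul_replicateRow, dotProduct_smul,
    smul_eq_mul]

theorem coeff_zero_starPoly {p : k[X]} (hp : p.Monic) :
    (starPoly p).coeff 0 = (p.coeff 0)⁻¹ := by
  rw [starPoly, coeff_C_mul, coeff_zero_reverse, hp.leadingCoeff, mul_one]

theorem starPoly_starPoly {p : k[X]} (hp : p.Monic) (hp0 : p.coeff 0 ≠ 0) :
    starPoly (starPoly p) = p := by
  have hdeg : p.reverse.natDegree = p.natDegree := by
    rw [reverse_natDegree, natTrailingDegree_eq_zero.2 (Or.inr hp0), Nat.sub_zero]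
  have hrev : p.reverse.reverse = p := by
    rw [reverse, hdeg, reverse, reflect_reflect]
  rw [starPoly, coeff_zero_starPoly hp, inv_inv, starPoly, reverse_mul_of_domain, reverse_C, hrev,
    ← mul_assoc, ← C_mul, mul_inv_cancel₀ hp0, C_1, one_mul]

theorem starPoly_X_sub_C {a : k} (ha : a * a = 1) : starPoly (X - C a) = X - C a := by
  have ha0 : a ≠ 0 := left_ne_zero_of_mul_eq_one ha
  have hr : (X - C a).reverse = 1 - C a * X := by
    rw [sub_eq_add_neg, ← C_neg, reverse_add_C, natDegree_X, pow_one, C_neg, ← one_mul (X : k[X]),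
      reverse_mul_X, ← C_1, reverse_C]
    ring
  have hinv : a⁻¹ = a := inv_eq_of_mul_eq_one_left ha
  rw [starPoly, hr, coeff_sub, coeff_X_zero, coeff_C_zero, zero_sub, inv_neg, hinv, mul_sub,
    ← mul_assoc, ← C_mul, neg_mul, ha, C_neg, C_neg, C_1]
  ring

theorem exists_algHom_quotient_inv {p q : k[X]} (hp0 : p.coeff 0 ≠ 0) (hq : q = starPoly p) :
    ∃ J : (k[X] ⧸ Ideal.span {q}) →ₐ[k] (k[X] ⧸ Ideal.span {p}),
      Ideal.Quotient.mk _ X * J (Ideal.Quotient.mk _ X) = 1 := by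
  let x : k[X] ⧸ Ideal.span {p} := Ideal.Quotient.mk _ X
  have hxinv : x * Ideal.Quotient.mk _ (-p.divX * C (p.coeff 0)⁻¹) = 1 := by
    rw [← map_mul, ← map_one (Ideal.Quotient.mk _), Ideal.Quotient.mk_eq_mk_iff_sub_mem,
      Ideal.mem_span_singleton]
    refine ⟨-C (p.coeff 0)⁻¹, ?_⟩
    have h1 : C (p.coeff 0) * C (p.coeff 0)⁻¹ = (1 : k[X]) := by
      rw [← C_mul, mul_inv_cancel₀ hp0, C_1]
    linear_combination (-C (p.coeff 0)⁻¹) * p.divX_mul_X_add + h1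
  let _ : Invertible x := invertibleOfRightInverse _ _ hxinv
  have hroot : ∀ a ∈ Ideal.span {q}, aeval (⅟x) a = 0 := by
    intro a ha
    obtain ⟨c, rfl⟩ := Ideal.mem_span_singleton.1 ha
    have h : aeval (⅟x) p.reverse = 0 := by
      rw [aeval_def, eval₂_reverse_eq_zero_iff, ← aeval_def]
      change aeval (Ideal.Quotient.mkₐ k _ X) p = 0
      rw [aeval_algHom_apply, aeval_X_left_apply]
      exact Ideal.Quotient.eq_zero_iff_mem.2 (Ideal.mem_span_singleton_self p)
    rw [map_mul, hq, starPoly, map_mul, h, mul_zero, zero_mul]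
  refine ⟨Ideal.Quotient.liftₐ _ (aeval (⅟x)) hroot, ?_⟩
  change x * aeval (⅟x) X = 1
  rw [aeval_X, mul_invOf_self]

theorem algHom_quotient_inv_comp {p q : k[X]}
    (J : (k[X] ⧸ Ideal.span {q}) →ₐ[k] (k[X] ⧸ Ideal.span {p}))
    (hJ : Ideal.Quotient.mk _ X * J (Ideal.Quotient.mk _ X) = 1)
    (J' : (k[X] ⧸ Ideal.span {p}) →ₐ[k] (k[X] ⧸ Ideal.span {q}))
    (hJ' : Ideal.Quotient.mk _ X * J' (Ideal.Quotient.mk _ X) = 1)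
    (u : k[X] ⧸ Ideal.span {p}) : J (J' u) = u := by
  have h : J.comp J' = AlgHom.id k _ := by
    refine Ideal.Quotient.algHom_ext _ (Polynomial.algHom_ext ?_)
    change J (J' (Ideal.Quotient.mk _ X)) = Ideal.Quotient.mk _ X
    have h1 := congrArg J hJ'
    rw [map_mul, map_one] at h1
    linear_combination (-J (J' (Ideal.Quotient.mk _ X))) * hJ + (Ideal.Quotient.mk _ X) * h1
  exact DFunLike.congr_fun h u

section Quotient

variable {p : k[X]}

theorem exists_mul_eq_one_of_quotient_irreducible (hp : Irreducible p)
    {u : k[X] ⧸ Ideal.span {p}} (hu : u ≠ 0) : ∃ w, u * w = 1 :=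
  have := PrincipalIdealRing.isMaximal_of_irreducible hp
  Ideal.Quotient.exists_inv hu

theorem exists_dual_one_ne_zero (hp : Irreducible p) :
    ∃ s : (k[X] ⧸ Ideal.span {p}) →ₗ[k] k, s 1 ≠ 0 := by
  have := PrincipalIdealRing.isMaximal_of_irreducible hp
  have : Nontrivial (k[X] ⧸ Ideal.span {p}) := Ideal.Quotient.nontrivial_iff.2 this.ne_top
  by_contra! h
  exact one_ne_zero ((Module.forall_dual_apply_eq_zero_iff k (1 : k[X] ⧸ Ideal.span {p})).1 h)

theorem exists_invariant_pairing {q : k[X]} (hpm : p.Monic) (hp : Irreducible p)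
    (hp0 : p.coeff 0 ≠ 0) (hq : q = starPoly p) :
    ∃ γ : (k[X] ⧸ Ideal.span {p}) →ₗ[k] (k[X] ⧸ Ideal.span {q}) →ₗ[k] k,
      (∀ u v, γ ((X : k[X]) • u) ((X : k[X]) • v) = γ u v) ∧
      (∀ u, u ≠ 0 → ∃ v, γ u v ≠ 0) ∧ ∀ v, v ≠ 0 → ∃ u, γ u v ≠ 0 := by
  obtain ⟨J, hJ⟩ := exists_algHom_quotient_inv hp0 hq
  obtain ⟨J', hJ'⟩ := exists_algHom_quotient_inv (p := q) (q := p)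
    (by rw [hq, coeff_zero_starPoly hpm]; exact inv_ne_zero hp0)
    (by rw [hq, starPoly_starPoly hpm hp0])
  obtain ⟨s, hs⟩ := exists_dual_one_ne_zero hp
  have hJJ' := algHom_quotient_inv_comp J hJ J' hJ'
  have hJ'J := algHom_quotient_inv_comp J' hJ' J hJ
  refine ⟨((LinearMap.mul k _).compl₂ J.toLinearMap).compr₂ s, ?_, ?_, ?_⟩
  · intro u v
    change s ((Ideal.Quotient.mk _ X * u) * J (Ideal.Quotient.mk _ X * v)) = s (u * J v)
    refine congrArg s ?_
    rw [map_mul]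
    linear_combination (u * J v) * hJ
  · intro u hu
    obtain ⟨w, hw⟩ := exists_mul_eq_one_of_quotient_irreducible hp hu
    refine ⟨J' w, ?_⟩
    change s (u * J (J' w)) ≠ 0
    rwa [hJJ', hw]
  · intro v hv
    have hJv : J v ≠ 0 := fun h => hv (by rw [← hJ'J v, h, map_zero])
    obtain ⟨w, hw⟩ := exists_mul_eq_one_of_quotient_irreducible hp hJv
    refine ⟨w, ?_⟩
    change s (w * J v) ≠ 0
    rwa [mul_comm, hw]

theorem exists_invariant_symm_form (hchar : (2 : k) ≠ 0) (hp : Irreducible p)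
    (hp0 : p.coeff 0 ≠ 0) (hself : p = starPoly p) :
    ∃ δ : (k[X] ⧸ Ideal.span {p}) →ₗ[k] (k[X] ⧸ Ideal.span {p}) →ₗ[k] k,
      (∀ u v, δ u v = δ v u) ∧
      (∀ u v, δ ((X : k[X]) • u) ((X : k[X]) • v) = δ u v) ∧
      (∀ u, u ≠ 0 → ∃ v, δ u v ≠ 0) ∧ δ 1 1 ≠ 0 := by
  obtain ⟨J, hJ⟩ := exists_algHom_quotient_inv hp0 hself
  obtain ⟨s, hs⟩ := exists_dual_one_ne_zero hp
  have hJJ := algHom_quotient_inv_comp J hJ J hJ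
  let γ := ((LinearMap.mul k _).compl₂ J.toLinearMap).compr₂ s
  have hγ : ∀ u v, (γ + γ.flip) u v = s (u * J v) + s (v * J u) := fun u v => rfl
  have h2 : s 1 + s 1 ≠ 0 := by
    rw [← two_mul]; exact mul_ne_zero hchar hs
  refine ⟨γ + γ.flip, ?_, ?_, ?_, ?_⟩
  · intro u v
    rw [hγ, hγ, add_comm]
  · intro u v
    have h : ∀ u v : k[X] ⧸ Ideal.span {p},
        ((X : k[X]) • u) * J ((X : k[X]) • v) = u * J v := by
      intro u v
      change (Ideal.Quotient.mk _ X * u) * J (Ideal.Quotient.mk _ X * v) = u * J v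
      rw [map_mul]
      linear_combination (u * J v) * hJ
    rw [hγ, hγ, h, h]
  · intro u hu
    obtain ⟨w, hw⟩ := exists_mul_eq_one_of_quotient_irreducible hp hu
    refine ⟨J w, ?_⟩
    rwa [hγ, hJJ, hw, ← map_mul J, mul_comm w, hw, map_one J]
  · rwa [hγ, map_one, mul_one]

end Quotient

section Forms

variable {V : Type} [AddCommGroup V] [Module k V] {n : Type} [Fintype n] [DecidableEq n]

theorem IsQuadraticSpace.det_toMatrix₂_ne_zero {B : LinearMap.BilinForm k V}
    (hB : IsQuadraticSpace B) (b : Module.Basis n k V) :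
    (LinearMap.toMatrix₂ b b B).det ≠ 0 :=
  (LinearMap.separatingLeft_iff_det_ne_zero b).1 hB.2

theorem isQuadraticSpace_of_det_ne_zero {B : LinearMap.BilinForm k V}
    (hB : ∀ x y, B x y = B y x) (b : Module.Basis n k V)
    (hdet : (LinearMap.toMatrix₂ b b B).det ≠ 0) : IsQuadraticSpace B :=
  ⟨hB, (LinearMap.separatingLeft_iff_det_ne_zero b).2 hdet⟩

theorem isSquare_det_mul_charpoly_of_isometry [Module.Finite k V] (hchar : (2 : k) ≠ 0)
    {B : LinearMap.BilinForm k V} (hB : IsQuadraticSpace B) (T : V →ₗ[k] V)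
    (hT : ∀ x y, B (T x) (T y) = B x y) (hT1 : T.charpoly.eval (-1) ≠ 0)
    (b : Module.Basis n k V) :
    IsSquare ((LinearMap.toMatrix₂ b b B).det *
      (T.charpoly.eval 1 * T.charpoly.eval (-1))) := by
  rw [← LinearMap.charpoly_toMatrix T b] at hT1 ⊢
  refine Matrix.isSquare_det_mul_of_isometry hchar _ _ ?_ (hB.det_toMatrix₂_ne_zero b) ?_ hT1
  · ext i j
    rw [Matrix.transpose_apply, LinearMap.toMatrix₂_apply, LinearMap.toMatrix₂_apply, hB.1]
  · rw [← LinearMap.toMatrix₂_compl₁₂ b b b b B T T]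
    congr 1
    exact LinearMap.ext₂ hT

theorem exists_isometric_form_det_eq {B : LinearMap.BilinForm k V} (hB : IsQuadraticSpace B)
    (T : V →ₗ[k] V) (hT : ∀ x y, B (T x) (T y) = B x y) {v : V} {ε : k} (hε : ε * ε = 1)
    (hv : T v = ε • v) (hvv : B v v ≠ 0) {d : k} (hd : d ≠ 0) (b : Module.Basis n k V) :
    ∃ B' : LinearMap.BilinForm k V, IsQuadraticSpace B' ∧
      (∀ x y, B' (T x) (T y) = B' x y) ∧
      ∃ c : k, c ≠ 0 ∧ (LinearMap.toMatrix₂ b b B').det = d * c ^ 2 := by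
  set G := LinearMap.toMatrix₂ b b B with hG
  have hG0 : G.det ≠ 0 := hB.det_toMatrix₂_ne_zero b
  let a : k := (d * G.det - 1) / B v v
  let B' : LinearMap.BilinForm k V := B + a • (LinearMap.mul k k).compl₁₂ (B v) (B v)
  have hB' : ∀ x y, B' x y = B x y + a * (B v x * B v y) := fun x y => rfl
  have hrepr : ∀ x, B x v = ∑ j, B x (b j) * b.repr v j := by
    intro x
    conv_lhs => rw [← b.sum_repr v]
    simp only [map_sum, map_smul, smul_eq_mul, mul_comm]
  have hGv : G.mulVec (b.repr v) = fun i => B v (b i) := by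
    ext i
    rw [hB.1, hrepr]
    simp only [Matrix.mulVec, dotProduct, hG, LinearMap.toMatrix₂_apply]
  have hdot : (fun i => B v (b i)) ⬝ᵥ (b.repr v) = B v v := (hrepr v).symm
  have hmat : LinearMap.toMatrix₂ b b B' =
      G + a • Matrix.vecMulVec (G.mulVec (b.repr v)) fun i => B v (b i) := by
    ext i j
    rw [LinearMap.toMatrix₂_apply, hB', hGv, Matrix.add_apply, hG, LinearMap.toMatrix₂_apply]
    rfl
  have hdet : (LinearMap.toMatrix₂ b b B').det = d * G.det ^ 2 := by
    rw [hmat, Matrix.det_add_smul_vecMulVec, hdot, div_mul_cancel₀ _ hvv]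
    ring
  refine ⟨B', isQuadraticSpace_of_det_ne_zero ?_ b ?_, ?_, G.det, hG0, hdet⟩
  · intro x y
    rw [hB', hB', hB.1 x y]
    ring
  · rw [hdet]
    exact mul_ne_zero hd (pow_ne_zero 2 hG0)
  · have hvT : ∀ x, B v (T x) = ε * B v x := by
      intro x
      rw [← hT v x, hv, map_smul, LinearMap.smul_apply, smul_eq_mul, ← mul_assoc, hε, one_mul]
    intro x y
    rw [hB', hB', hT, hvT, hvT]
    linear_combination (a * (B v x * B v y)) * hε

end Forms

section Pi

variable {J : Type} [Fintype J] {E : J → Type} [∀ j, AddCommGroup (E j)] [∀ j, Module k (E j)]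

theorem LinearMap.eval_charpoly_piMap [∀ j, Module.Finite k (E j)] (T : ∀ j, E j →ₗ[k] E j)
    (a : k) : (LinearMap.pi fun j => (T j).comp (LinearMap.proj j)).charpoly.eval a =
      ∏ j, (T j).charpoly.eval a := by
  let _ : LinearOrder J := by classical exact linearOrderOfSTO (WellOrderingRel (α := J))
  let b := fun j => Module.finBasis k (E j)
  have hmat : LinearMap.toMatrix (Pi.basis b) (Pi.basis b)
      (LinearMap.pi fun j => (T j).comp (LinearMap.proj j)) =
      Matrix.blockDiagonal' fun j => LinearMap.toMatrix (b j) (b j) (T j) := by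
    ext ⟨i, r⟩ ⟨j, s⟩
    rw [LinearMap.toMatrix_apply, Pi.basis_apply, Pi.basis_repr, Matrix.blockDiagonal'_apply]
    by_cases h : i = j
    · subst h
      simp [LinearMap.toMatrix_apply]
    · simp [h]
  rw [← LinearMap.charpoly_toMatrix _ (Pi.basis b), hmat, Matrix.eval_charpoly]
  have hscalar : Matrix.scalar _ a -
      Matrix.blockDiagonal' (fun j => LinearMap.toMatrix (b j) (b j) (T j)) =
      Matrix.blockDiagonal' fun j => Matrix.scalar _ a - LinearMap.toMatrix (b j) (b j) (T j) := by
    change _ = Matrix.blockDiagonal' ((fun j => Matrix.scalar _ a) -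
      fun j => LinearMap.toMatrix (b j) (b j) (T j))
    rw [Matrix.blockDiagonal'_sub]
    congr 1
    simp only [Matrix.scalar_apply]
    exact (Matrix.blockDiagonal'_diagonal fun _ _ => a).symm
  rw [hscalar, (Matrix.blockTriangular_blockDiagonal' _).det_fintype]
  refine Finset.prod_congr rfl fun j _ => ?_
  rw [← LinearMap.charpoly_toMatrix _ (b j), Matrix.eval_charpoly]
  let e : Fin (Module.finrank k (E j)) ≃
      {x : Σ j, Fin (Module.finrank k (E j)) // x.1 = j} := Equiv.ofBijective
    (fun r => ⟨⟨j, r⟩, rfl⟩) ⟨fun r s h => by simpa using h, fun ⟨⟨i, r⟩, h⟩ => by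
      subst h; exact ⟨r, rfl⟩⟩
  rw [← Matrix.det_submatrix_equiv_self e]
  congr 1
  ext r s
  exact Matrix.blockDiagonal'_apply_eq
    (fun j => Matrix.scalar _ a - LinearMap.toMatrix (b j) (b j) (T j)) j r s

theorem exists_form_of_pairings [DecidableEq J] (T : ∀ j, E j →ₗ[k] E j)
    (τ : Equiv.Perm J) (S L : J → Prop)
    (hcover : ∀ j, S j ∨ L j ∨ ∃ i, L i ∧ τ i = j) (hLS : ∀ j, L j → ¬S j)
    (hτS : ∀ j, L j → ¬S (τ j)) (hτL : ∀ j, L j → ¬L (τ j))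
    (δ : ∀ j, E j →ₗ[k] E j →ₗ[k] k) (hδ0 : ∀ j, ¬S j → δ j = 0)
    (hδs : ∀ j u v, δ j u v = δ j v u) (hδT : ∀ j u v, δ j (T j u) (T j v) = δ j u v)
    (hδ : ∀ j, S j → ∀ u, u ≠ 0 → ∃ v, δ j u v ≠ 0)
    (γ : ∀ j, E j →ₗ[k] E (τ j) →ₗ[k] k) (hγ0 : ∀ j, ¬L j → γ j = 0)
    (hγT : ∀ j u v, γ j (T j u) (T (τ j) v) = γ j u v)
    (hγl : ∀ j, L j → ∀ u, u ≠ 0 → ∃ v, γ j u v ≠ 0)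
    (hγr : ∀ j, L j → ∀ v, v ≠ 0 → ∃ u, γ j u v ≠ 0) :
    ∃ B : LinearMap.BilinForm k (∀ j, E j), IsQuadraticSpace B ∧
      (∀ x y, B (fun j => T j (x j)) (fun j => T j (y j)) = B x y) ∧
      ∀ j, S j → ∀ u v, B (Pi.single j u) (Pi.single j v) = δ j u v := by
  let P : ∀ j, (∀ j, E j) →ₗ[k] E j := fun j => LinearMap.proj j
  let B : LinearMap.BilinForm k (∀ j, E j) := ∑ j, ((δ j).compl₁₂ (P j) (P j) +
    ((γ j).compl₁₂ (P j) (P (τ j)) + ((γ j).compl₁₂ (P j) (P (τ j))).flip))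
  have hB : ∀ x y, B x y = ∑ j, (δ j (x j) (y j) +
      (γ j (x j) (y (τ j)) + γ j (y j) (x (τ j)))) := by
    intro x y
    simp only [B, LinearMap.sum_apply]
    rfl
  have hsymm : ∀ x y, B x y = B y x := by
    intro x y
    rw [hB, hB]
    refine Finset.sum_congr rfl fun j _ => ?_
    rw [hδs, add_comm (γ j (x j) _)]
  have hBS : ∀ j, S j → ∀ x v, B x (Pi.single j v) = δ j (x j) v := by
    intro j hj x v
    rw [hB, Finset.sum_eq_single j]
    · rw [hγ0 j fun h => hLS j h hj]
      simp
    · intro i _ hij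
      rw [Pi.single_eq_of_ne hij]
      by_cases hi : L i
      · rw [Pi.single_eq_of_ne (fun h : τ i = j => hτS i hi (h ▸ hj))]
        simp
      · simp [hγ0 i hi]
    · simp
  have hBτ : ∀ j, L j → ∀ x v, B x (Pi.single (τ j) v) = γ j (x j) v := by
    intro j hj x v
    have hzero : ∀ i, δ i (x i) (Pi.single (τ j) v i : E i) = 0 ∧
        γ i (Pi.single (τ j) v i : E i) (x (τ i)) = 0 := by
      intro i
      by_cases hi : i = τ j
      · subst hi
        simp [hδ0 _ (hτS j hj), hγ0 _ (hτL j hj)]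
      · simp [Pi.single_eq_of_ne hi]
    rw [hB, Finset.sum_eq_single j]
    · rw [(hzero j).1, (hzero j).2]
      simp
    · intro i _ hij
      rw [(hzero i).1, (hzero i).2, Pi.single_eq_of_ne (fun h => hij (τ.injective h))]
      simp
    · simp
  have hBL : ∀ j, L j → ∀ x u, B x (Pi.single j u) = γ j u (x (τ j)) := by
    intro j hj x u
    have hzero : ∀ i, δ i (x i) (Pi.single j u i : E i) = 0 ∧
        γ i (x i) (Pi.single j u (τ i) : E (τ i)) = 0 := by
      intro i
      constructor
      · by_cases hi : i = j
        · subst hi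
          simp [hδ0 _ (hLS i hj)]
        · simp [Pi.single_eq_of_ne hi]
      · by_cases hi : L i
        · rw [Pi.single_eq_of_ne (fun h : τ i = j => hτL i hi (h ▸ hj))]
          simp
        · simp [hγ0 i hi]
    rw [hB, Finset.sum_eq_single j]
    · rw [(hzero j).1, (hzero j).2]
      simp
    · intro i _ hij
      rw [(hzero i).1, (hzero i).2, Pi.single_eq_of_ne hij]
      simp
    · simp
  refine ⟨B, ⟨hsymm, ?_⟩, ?_, ?_⟩
  · intro x hx
    by_contra hx0
    obtain ⟨j, hj⟩ := Function.ne_iff.1 hx0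
    rcases hcover j with h | h | ⟨i, h, rfl⟩
    · obtain ⟨v, hv⟩ := hδ j h _ hj
      exact hv (by rw [← hBS j h, hx])
    · obtain ⟨v, hv⟩ := hγl j h _ hj
      exact hv (by rw [← hBτ j h, hx])
    · obtain ⟨u, hu⟩ := hγr i h _ hj
      exact hu (by rw [← hBL i h, hx])
  · intro x y
    simp only [hB, hδT, hγT]
  · intro j hj u v
    rw [hBS j hj, Pi.single_eq_same]

end Pi

theorem eval_charpoly_mul_X_quotient {p : k[X]} (hp : p.Monic)
    [Module.Finite k (k[X] ⧸ Ideal.span {p})] (a : k) :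
    (Module.toModuleEnd k (k[X] ⧸ Ideal.span {p}) (X : k[X])).charpoly.eval a = p.eval a := by
  have : Module.Finite k (AdjoinRoot p) := hp.finite_adjoinRoot
  let b := AdjoinRoot.powerBasis hp.ne_zero
  have hT : Algebra.lmul k (AdjoinRoot p) b.gen =
      Module.toModuleEnd k (k[X] ⧸ Ideal.span {p}) (X : k[X]) := rfl
  have h := charpoly_leftMulMatrix b
  rw [AdjoinRoot.minpoly_powerBasis_gen_of_monic hp, Algebra.leftMulMatrix_apply,
    LinearMap.charpoly_toMatrix] at h
  exact congrArg (eval a) h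

namespace ModuleData

variable (D : ModuleData k)

theorem coeff_zero_ne_zero (i : D.ι) : (D.f i).coeff 0 ≠ 0 := by
  intro h
  obtain ⟨σ, hσ⟩ := D.selfdual
  refine (D.irr (σ i)).ne_zero ?_
  rw [(hσ i).1, starPoly, h, inv_zero, C_0, zero_mul]

variable {D}

theorem Semisimple.map_id_pow (hss : D.Semisimple) (i : D.ι) :
    (D.f i).map (RingHom.id k) ^ D.e i = D.f i := by
  rw [Polynomial.map_id, hss i, pow_one]

variable (D)

/-- The cyclic summand of `M` indexed by `j`. -/
abbrev Summand (j : Σ i, Fin (D.n i)) : Type :=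
  k[X] ⧸ Ideal.span {(D.f j.1).map (RingHom.id k) ^ D.e j.1}

instance (j : Σ i, Fin (D.n i)) : Module.Finite k (D.Summand j) :=
  (((D.monic j.1).map (RingHom.id k)).pow _).finite_quotient

/-- Multiplication by `X` on the sum of the cyclic summands of `M`. -/
def mulX : (∀ j, D.Summand j) →ₗ[k] ∀ j, D.Summand j :=
  LinearMap.pi fun j => (Module.toModuleEnd k (D.Summand j) (X : k[X])).comp (LinearMap.proj j)

theorem eval_charpoly_mulX (a : k) : D.mulX.charpoly.eval a = D.charPoly.eval a := by
  have h : ∀ j : Σ i, Fin (D.n i),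
      (Module.toModuleEnd k (D.Summand j) (X : k[X])).charpoly.eval a =
        (D.f j.1).eval a ^ D.e j.1 := by
    intro j
    rw [eval_charpoly_mul_X_quotient (((D.monic j.1).map (RingHom.id k)).pow _), eval_pow,
      Polynomial.map_id]
  rw [mulX, LinearMap.eval_charpoly_piMap, Fintype.prod_congr _ _ h, Fintype.prod_sigma, charPoly,
    eval_prod]
  refine Finset.prod_congr rfl fun i _ => ?_
  change ∏ _ : Fin (D.n i), (D.f i).eval a ^ D.e i = _
  rw [Finset.prod_const, Finset.card_univ, Fintype.card_fin, ← pow_mul, eval_pow, mul_comm]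

theorem finrank_pi_summand : Module.finrank k (∀ j, D.Summand j) = D.dim := by
  rw [Module.finrank_pi_fintype, Fintype.sum_sigma, dim]
  refine Finset.sum_congr rfl fun i _ => ?_
  have h : Module.finrank k
      (k[X] ⧸ Ideal.span {(D.f i).map (RingHom.id k) ^ D.e i}) = D.e i * (D.f i).natDegree := by
    rw [finrank_quotient_span_eq_natDegree, natDegree_pow, Polynomial.map_id]
  simp only [h, Finset.sum_const, Finset.card_univ, Fintype.card_fin, smul_eq_mul]

open Classical in
theorem exists_invariant_form (hchar : (2 : k) ≠ 0) (hss : D.Semisimple) :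
    ∃ B : LinearMap.BilinForm k (∀ j, D.Summand j), IsQuadraticSpace B ∧
      (∀ x y, B (D.mulX x) (D.mulX y) = B x y) ∧
      ∀ j, D.f j.1 = starPoly (D.f j.1) →
        B (Pi.single j 1) (Pi.single j 1) ≠ 0 := by
  obtain ⟨σ, hσ⟩ := D.selfdual
  let τ : Equiv.Perm (Σ i, Fin (D.n i)) :=
    Equiv.sigmaCongr σ fun i => finCongr (hσ i).2.2.symm
  have hτ : ∀ j, D.f (τ j).1 = starPoly (D.f j.1) := fun j => (hσ j.1).1
  have hss' : ∀ j, starPoly (starPoly (D.f j)) = D.f j := fun j =>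
    starPoly_starPoly (D.monic j) (D.coeff_zero_ne_zero j)
  let S : (Σ i, Fin (D.n i)) → Prop := fun j => D.f j.1 = starPoly (D.f j.1)
  let L : (Σ i, Fin (D.n i)) → Prop := fun j => WellOrderingRel (D.f j.1) (starPoly (D.f j.1))
  have hδ : ∀ j : Σ i, Fin (D.n i), ∃ δ : D.Summand j →ₗ[k] D.Summand j →ₗ[k] k,
      (¬S j → δ = 0) ∧ (∀ u v, δ u v = δ v u) ∧
      (∀ u v, δ ((X : k[X]) • u) ((X : k[X]) • v) = δ u v) ∧
      (S j → (∀ u, u ≠ 0 → ∃ v, δ u v ≠ 0) ∧ δ 1 1 ≠ 0) := by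
    intro j
    by_cases hj : S j
    · have hp := hss.map_id_pow j.1
      have h0 := D.coeff_zero_ne_zero j.1
      have hirr := D.irr j.1
      have hself : D.f j.1 = starPoly (D.f j.1) := hj
      rw [← hp] at h0 hirr hself
      obtain ⟨δ, h1, h2, h3⟩ := exists_invariant_symm_form hchar hirr h0 hself
      exact ⟨δ, fun h => absurd hj h, h1, h2, fun _ => h3⟩
    · exact ⟨0, fun _ => rfl, fun _ _ => rfl, fun _ _ => rfl, fun h => absurd h hj⟩
  have hγ : ∀ j : Σ i, Fin (D.n i), ∃ γ : D.Summand j →ₗ[k] D.Summand (τ j) →ₗ[k] k,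
      (¬L j → γ = 0) ∧ (∀ u v, γ ((X : k[X]) • u) ((X : k[X]) • v) = γ u v) ∧
      (L j → (∀ u, u ≠ 0 → ∃ v, γ u v ≠ 0) ∧ ∀ v, v ≠ 0 → ∃ u, γ u v ≠ 0) := by
    intro j
    by_cases hj : L j
    · have hp := hss.map_id_pow j.1
      have hq := hss.map_id_pow (τ j).1
      have h0 := D.coeff_zero_ne_zero j.1
      have hirr := D.irr j.1
      have hm := D.monic j.1
      have hdual := hτ j
      rw [← hp] at h0 hirr hm hdual
      rw [← hq] at hdual
      obtain ⟨γ, h1, h2⟩ := exists_invariant_pairing hm hirr h0 hdual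
      exact ⟨γ, fun h => absurd hj h, h1, fun _ => h2⟩
    · exact ⟨0, fun _ => rfl, fun _ _ => rfl, fun h => absurd h hj⟩
  choose δ hδ0 hδs hδT hδn using hδ
  choose γ hγ0 hγT hγn using hγ
  obtain ⟨B, hB, hBT, hBS⟩ := exists_form_of_pairings (E := D.Summand)
    (fun j => Module.toModuleEnd k (D.Summand j) (X : k[X])) τ S L
    (fun j => by
      rcases trichotomous_of WellOrderingRel (D.f j.1) (starPoly (D.f j.1)) with h | h | h
      · exact Or.inr (Or.inl h)
      · exact Or.inl h
      · refine Or.inr (Or.inr ⟨τ.symm j, ?_, τ.apply_symm_apply j⟩)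
        have h' := hτ (τ.symm j)
        rw [τ.apply_symm_apply] at h'
        change WellOrderingRel _ _
        rwa [← h', ← hss' (τ.symm j).1, ← h'])
    (fun j hj hjS => by
      have h : WellOrderingRel (D.f j.1) (starPoly (D.f j.1)) := hj
      rw [← show D.f j.1 = starPoly (D.f j.1) from hjS] at h
      exact irrefl_of WellOrderingRel _ h)
    (fun j hj hjS => by
      have h : D.f (τ j).1 = starPoly (D.f (τ j).1) := hjS
      rw [hτ, hss'] at h
      have h' : WellOrderingRel (D.f j.1) (starPoly (D.f j.1)) := hj
      rw [h] at h'
      exact irrefl_of WellOrderingRel _ h')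
    (fun j hj hjL => by
      have h : WellOrderingRel (D.f (τ j).1) (starPoly (D.f (τ j).1)) := hjL
      rw [hτ, hss'] at h
      exact asymm_of WellOrderingRel h hj)
    δ hδ0 hδs hδT (fun j hj => (hδn j hj).1) γ hγ0 hγT
    (fun j hj => (hγn j hj).1) (fun j hj => (hγn j hj).2)
  exact ⟨B, hB, hBT, fun j hj => by
    rw [hBS j hj]
    exact (hδn j hj).2⟩

open Classical in
theorem mulX_single_one {j : Σ i, Fin (D.n i)} {ε : k}
    (hj : (D.f j.1).map (RingHom.id k) ^ D.e j.1 = X - C ε) :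
    D.mulX (Pi.single j 1) = ε • (Pi.single j 1 : ∀ j, D.Summand j) := by
  have h1 : (X : k[X]) • (1 : D.Summand j) = ε • 1 := by
    have h : (Ideal.Quotient.mk _ (X - C ε) : D.Summand j) = 0 :=
      Ideal.Quotient.eq_zero_iff_mem.2 (hj ▸ Ideal.mem_span_singleton_self _)
    rw [map_sub, sub_eq_zero] at h
    have hε : ε • (1 : D.Summand j) = Ideal.Quotient.mk _ (C ε) := by
      rw [← Algebra.algebraMap_eq_smul_one]
      rfl
    rw [hε, ← h]
    exact mul_one (Ideal.Quotient.mk _ X : D.Summand j)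
  funext i
  change (X : k[X]) • (Pi.single j 1 : ∀ j, D.Summand j) i =
    ε • (Pi.single j 1 : ∀ j, D.Summand j) i
  by_cases hi : i = j
  · subst hi
    rw [Pi.single_eq_same, h1]
  · rw [Pi.single_eq_of_ne hi, smul_zero, smul_zero]

/-- An isometric form on the sum of the cyclic summands yields a form on `k ^ dim M`. -/
theorem hasIsometryWithModule_of_mulX_invariant (B : LinearMap.BilinForm k (∀ j, D.Summand j))
    (hB : IsQuadraticSpace B) (hBT : ∀ x y, B (D.mulX x) (D.mulX y) = B x y)
    (e : (Fin D.dim → k) ≃ₗ[k] ∀ j, D.Summand j) :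
    IsQuadraticSpace (B.compl₁₂ e.toLinearMap e.toLinearMap) ∧
      HasIsometryWithModule (B.compl₁₂ e.toLinearMap e.toLinearMap) D := by
  have hinj : Function.Injective D.mulX := by
    rw [injective_iff_map_eq_zero]
    intro x hx
    refine hB.2 x fun y => ?_
    rw [← hBT, hx, map_zero, LinearMap.zero_apply]
  refine ⟨⟨fun x y => hB.1 _ _, fun x hx => ?_⟩,
    (e.trans (LinearEquiv.ofInjectiveEndo D.mulX hinj)).trans e.symm, ?_,
    e.trans (LinearEquiv.piCurry k fun i a => D.Summand ⟨i, a⟩), ?_⟩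
  · refine e.map_eq_zero_iff.1 (hB.2 _ fun y => ?_)
    rw [← e.apply_symm_apply y]
    exact hx _
  · intro x y
    change B (e (e.symm (D.mulX (e x)))) (e (e.symm (D.mulX (e y)))) = B (e x) (e y)
    rw [e.apply_symm_apply, e.apply_symm_apply, hBT]
  · intro w
    change LinearEquiv.piCurry k (fun i a => D.Summand ⟨i, a⟩) (e (e.symm (D.mulX (e w)))) = _
    rw [e.apply_symm_apply]
    rfl

theorem exists_eq_X_sub_C_of_eval_eq_zero {a : k} (h : D.charPoly.eval a = 0) :
    ∃ i, D.f i = X - C a := by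
  rw [charPoly, eval_prod, Finset.prod_eq_zero_iff] at h
  obtain ⟨i, -, hi⟩ := h
  rw [eval_pow] at hi
  have hroot : (D.f i).IsRoot a := eq_zero_of_pow_eq_zero hi
  exact ⟨i, (eq_of_monic_of_associated (monic_X_sub_C a) (D.monic i)
    ((irreducible_X_sub_C a).associated_of_dvd (D.irr i) (dvd_iff_isRoot.2 hroot))).symm⟩

end ModuleData

/-- **Lemma 5.3.** If `M` is a semi-simple module and `d ∈ k*` is such
that `d·F_M(1)·F_M(−1)` is a square in `k` (possibly 0), then there is a quadratic
space of determinant `d` having an isometry with module `M`. -/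
theorem exists_quadraticSpace_det_hasIsometryWithModule_of_isSquare
    (hchar : (2 : k) ≠ 0)
    (D : ModuleData k) (hss : D.Semisimple)
    (d : k) (hd : d ≠ 0)
    (hsq : IsSquare (d * (D.charPoly.eval 1 * D.charPoly.eval (-1)))) :
    ∃ B : LinearMap.BilinForm k (Fin D.dim → k), IsQuadraticSpace B ∧
      (∃ c : k, c ≠ 0 ∧ detOf B = d * c ^ 2) ∧ HasIsometryWithModule B D := by
  let e : (Fin D.dim → k) ≃ₗ[k] ∀ j, D.Summand j := LinearEquiv.ofFinrankEq _ _ (by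
    rw [Module.finrank_fin_fun, D.finrank_pi_summand])
  let b := (Module.finBasis k (Fin D.dim → k)).map e
  suffices h : ∃ B : LinearMap.BilinForm k (∀ j, D.Summand j), IsQuadraticSpace B ∧
      (∀ x y, B (D.mulX x) (D.mulX y) = B x y) ∧
      ∃ c : k, c ≠ 0 ∧ (LinearMap.toMatrix₂ b b B).det = d * c ^ 2 by
    obtain ⟨B, hB, hBT, c, hc, hdet⟩ := h
    obtain ⟨hquad, hiso⟩ := D.hasIsometryWithModule_of_mulX_invariant B hB hBT e
    refine ⟨_, hquad, ⟨c, hc, ?_⟩, hiso⟩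
    rw [← hdet, detOf, gramOf]
    congr 1
  obtain ⟨B, hB, hBT, hBself⟩ := D.exists_invariant_form hchar hss
  have hrescale : ∀ ε : k, ε * ε = 1 → D.charPoly.eval ε = 0 →
      ∃ B : LinearMap.BilinForm k (∀ j, D.Summand j), IsQuadraticSpace B ∧
        (∀ x y, B (D.mulX x) (D.mulX y) = B x y) ∧
        ∃ c : k, c ≠ 0 ∧ (LinearMap.toMatrix₂ b b B).det = d * c ^ 2 := by
    intro ε hε h
    obtain ⟨i, hi⟩ := D.exists_eq_X_sub_C_of_eval_eq_zero h
    exact exists_isometric_form_det_eq hB D.mulX hBT hε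
      (D.mulX_single_one (j := ⟨i, 0, D.npos i⟩) ((hss.map_id_pow i).trans hi))
      (hBself ⟨i, 0, D.npos i⟩ (by rw [hi, starPoly_X_sub_C hε])) hd b
  by_cases h1 : D.charPoly.eval 1 = 0
  · exact hrescale 1 (one_mul 1) h1
  by_cases h2 : D.charPoly.eval (-1) = 0
  · exact hrescale (-1) (by ring) h2
  obtain ⟨r, hr⟩ := isSquare_det_mul_charpoly_of_isometry hchar hB D.mulX hBT
    (by rwa [D.eval_charpoly_mulX]) b
  obtain ⟨s, hs⟩ := hsq
  rw [D.eval_charpoly_mulX, D.eval_charpoly_mulX] at hr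
  have hF := mul_ne_zero h1 h2
  have hr0 : r ≠ 0 := by
    rintro rfl
    exact mul_ne_zero (hB.det_toMatrix₂_ne_zero b) hF (by rw [hr, zero_mul])
  have hs0 : s ≠ 0 := by
    rintro rfl
    exact mul_ne_zero hd hF (by rw [hs, zero_mul])
  refine ⟨B, hB, hBT, r / s, div_ne_zero hr0 hs0, mul_right_cancel₀ hF ?_⟩
  rw [hr, div_pow, mul_right_comm, hs]
  field_simp

end
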